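/- Case II, small area, moderately negative truncation. For every natural number N ≥ 4, every real α with 2π√3/(3N²) ≤ α ≤ 1/4, and every real T ∈ [−2.4, 0], one has 2√(π·(α − 2T)) + T·12^(1/4) + (N − 6)·0.0505 − 2α·12^(1/4) > 0. -/

import Mathlib

open Real

/-- A chord bound: on `[0, b² / π]` the function `u ↦ √(π u)` lies above its chord. -/
lemma pi_mul_le_mul_sqrt {u b : ℝ} (hu : 0 ≤ u) (hb : 0 ≤ b) (hub : π * u ≤ b ^ 2) :
    π * u ≤ b * √(π * u) := by
  have hs : √(π * u) ≤ b := Real.sqrt_le_iff.2 ⟨hb, hub⟩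
  calc π * u = √(π * u) * √(π * u) := (Real.mul_self_sqrt (by positivity)).symm
    _ ≤ b * √(π * u) := by gcongr

lemma twelve_rpow_quarter_le : (12 : ℝ) ^ ((1 : ℝ) / 4) ≤ 1.87 := by
  rw [one_div]
  exact (Real.rpow_inv_le_iff_of_pos (by norm_num) (by norm_num) (by norm_num)).2 (by norm_num)

/-- The lower bound on `2√(π u)` in terms of `u` and `α`, with slack `δ`. -/
lemma linear_lt_two_mul_sqrt_pi_mul {u α δ : ℝ} (hα : 0 < α) (hα' : α ≤ 1 / 4) (hαu : α ≤ u)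
    (hu : u ≤ 5.05) (hδ : δ ≤ 0.101) (hδα : δ ≤ α) :
    1.87 * (u / 2 + 3 / 2 * α) + δ < 2 * √(π * u) := by
  have hu₀ : 0 < u := hα.trans_le hαu
  have hlo : 3.14 * u ≤ π * u := by gcongr; exact Real.pi_gt_d2.le
  have hhi : π * u ≤ 3.15 * u := by gcongr; exact Real.pi_lt_d2.le
  rcases le_total u 0.4 with h | h
  · linarith [pi_mul_le_mul_sqrt (b := 1.13) hu₀.le (by norm_num) (by linarith)]
  rcases le_total u 1.4 with h' | h'
  · linarith [pi_mul_le_mul_sqrt (b := 2.1) hu₀.le (by norm_num) (by linarith)]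
  · linarith [pi_mul_le_mul_sqrt (b := 4) hu₀.le (by norm_num) (by linarith)]

/-- **Case II, small area, moderately negative truncation.**
For natural `N ≥ 4`, `2π√3/(3N²) ≤ α ≤ 1/4` and `T ∈ [−2.4, 0]`,
`2√(π(α − 2T)) + T·12^(1/4) + (N − 6)·0.0505 − 2α·12^(1/4) > 0`. -/
theorem caseII_small_area_negative_truncation (N : ℕ) (hN : 4 ≤ N) (α T : ℝ)
    (hα₁ : 2 * Real.pi * Real.sqrt 3 / (3 * (N : ℝ) ^ 2) ≤ α) (hα₂ : α ≤ 1 / 4)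
    (hT₁ : -2.4 ≤ T) (hT₂ : T ≤ 0) :
    2 * Real.sqrt (Real.pi * (α - 2 * T)) + T * (12 : ℝ) ^ ((1 : ℝ) / 4)
      + ((N : ℝ) - 6) * 0.0505 - 2 * α * (12 : ℝ) ^ ((1 : ℝ) / 4) > 0 := by
  have hN₀ : (4 : ℝ) ≤ N := by exact_mod_cast hN
  have hα : 0 < α := lt_of_lt_of_le (by positivity) hα₁
  have hslack : (6 - (N : ℝ)) * 0.0505 ≤ α := by
    rcases le_or_gt 6 N with h | h
    · have : (6 : ℝ) ≤ N := by exact_mod_cast h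
      linarith
    · have h5 : (N : ℝ) ≤ 5 := by exact_mod_cast Nat.le_of_lt_succ h
      have h3 : (1.7 : ℝ) ≤ √3 := Real.le_sqrt_of_sq_le (by norm_num)
      have : 2 * 3 * 1.7 / (3 * (5 : ℝ) ^ 2) ≤ 2 * π * √3 / (3 * (N : ℝ) ^ 2) := by
        gcongr
        exact Real.pi_gt_three.le
      linarith
  have key := linear_lt_two_mul_sqrt_pi_mul (u := α - 2 * T) hα hα₂ (by linarith) (by linarith)
    (by linarith) hslack
  have hc := mul_le_mul_of_nonneg_right twelve_rpow_quarter_le (by linarith : 0 ≤ 2 * α - T)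
  linarith
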